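/- Let G be a planar graph whose outer face boundary consists of a directed degree-4 vertex d and three degree-3 vertices r, s, t in cyclic order d, r, s, t, with all edges at d directed out of d, with prescriptions p(d) = p(t) = −1, p(r) = p(s) = 0, and p(A) = −1 where A = V(G) \ {d,r,s,t}. Then G has no orientation extending the orientation at d in which indeg(v) − outdeg(v) ≡ p(v) (mod 3) at every vertex. -/

import Mathlib

open Finset

/-- Orientation convention: `o e = true` means the edge is directed from `fst e` to `snd e`. -/
def edgeHead {V E : Type} (fst snd : E → V) (o : E → Bool) (e : E) : V :=
  if o e then snd e else fst e

def edgeTail {V E : Type} (fst snd : E → V) (o : E → Bool) (e : E) : V :=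
  if o e then fst e else snd e

/-- The degree of a vertex (no loops are present in the situation considered). -/
def degF {V E : Type} [Fintype E] [DecidableEq V] (fst snd : E → V) (v : V) : ℕ :=
  (univ.filter fun e => fst e = v ∨ snd e = v).card

theorem card_edgeHead_add_card_edgeTail {V E : Type} [Fintype E] [DecidableEq V]
    (fst snd : E → V) (hnoloop : ∀ e, fst e ≠ snd e) (o : E → Bool) (v : V) :
    (univ.filter (fun e => edgeHead fst snd o e = v)).card
      + (univ.filter (fun e => edgeTail fst snd o e = v)).card = degF fst snd v := by
  classical
  unfold degF
  rw [← card_union_of_disjoint, ← filter_or]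
  · congr 1
    ext e
    cases ho : o e <;> simp [edgeHead, edgeTail, ho, or_comm]
  · rw [disjoint_filter]
    intro e _ h₁ h₂
    have := hnoloop e
    cases ho : o e <;> simp_all [edgeHead, edgeTail]

/-- A graph whose outer face boundary is a 4-cycle `d, r, s, t` with `deg d = 4`,
`deg r = deg s = deg t = 3`, all edges at `d` directed out of `d`, prescriptions
`p d = p t = −1`, `p r = p s = 0`, and interior prescription summing to `−1`, has no valid
orientation extending the orientation at `d`. -/
theorem stmt4 {V E : Type} [Fintype V] [Fintype E] [DecidableEq V] [DecidableEq E]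
    (fst snd : E → V) (p : V → ZMod 3)
    (d r s t : V)
    (hvdist : d ≠ r ∧ d ≠ s ∧ d ≠ t ∧ r ≠ s ∧ r ≠ t ∧ s ≠ t)
    (edr ers est etd : E)
    (hedist : edr ≠ ers ∧ edr ≠ est ∧ edr ≠ etd ∧ ers ≠ est ∧ ers ≠ etd ∧ est ≠ etd)
    (hedr : fst edr = d ∧ snd edr = r)
    (hers : fst ers = r ∧ snd ers = s)
    (hest : fst est = s ∧ snd est = t)
    (hetd : fst etd = t ∧ snd etd = d)
    (hnoloop : ∀ e, fst e ≠ snd e)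
    (hdegd : degF fst snd d = 4)
    (hdegr : degF fst snd r = 3)
    (hdegs : degF fst snd s = 3)
    (hdegt : degF fst snd t = 3)
    (hpd : p d = -1) (hpt : p t = -1) (hpr : p r = 0) (hps : p s = 0)
    (hpint : ∑ v ∈ univ \ ({d, r, s, t} : Finset V), p v = -1)
    (hpsum : ∑ v, p v = 0) :
    ¬ ∃ o : E → Bool,
        (∀ e, (fst e = d ∨ snd e = d) → edgeTail fst snd o e = d) ∧
        ∀ v, ((univ.filter (fun e => edgeHead fst snd o e = v)).card : ZMod 3)
            - ((univ.filter (fun e => edgeTail fst snd o e = v)).card : ZMod 3) = p v := by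
  rintro ⟨o, hd, ho⟩
  obtain ⟨-, hds, hdt, hrs, -, hst⟩ := hvdist
  have hsum := card_edgeHead_add_card_edgeTail fst snd hnoloop o
  have head_pos : ∀ e v, edgeHead fst snd o e = v →
      0 < (univ.filter (fun e => edgeHead fst snd o e = v)).card :=
    fun e v h => card_pos.mpr ⟨e, by simpa using h⟩
  have tail_pos : ∀ e v, edgeTail fst snd o e = v →
      0 < (univ.filter (fun e => edgeTail fst snd o e = v)).card :=
    fun e v h => card_pos.mpr ⟨e, by simpa using h⟩
  have all_in_or_out : ∀ a b : ℕ, a + b = 3 → (a : ZMod 3) - b = 0 → a = 0 ∨ b = 0 := by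
    intro a b hab h
    obtain rfl : b = 3 - a := by omega
    have ha : a ≤ 3 := by omega
    interval_cases a <;> revert h <;> decide
  have in_le_one : ∀ a b : ℕ, a + b = 3 → (a : ZMod 3) - b = -1 → a ≤ 1 := by
    intro a b hab h
    obtain rfl : b = 3 - a := by omega
    have ha : a ≤ 3 := by omega
    interval_cases a <;> revert h <;> decide
  have hr := all_in_or_out _ _ ((hsum r).trans hdegr) ((ho r).trans hpr)
  have hs := all_in_or_out _ _ ((hsum s).trans hdegs) ((ho s).trans hps)
  have ht := in_le_one _ _ ((hsum t).trans hdegt) ((ho t).trans hpt)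
  have odr : edgeHead fst snd o edr = r := by
    have := hd edr (Or.inl hedr.1)
    cases h : o edr <;> simp_all [edgeHead, edgeTail]
  have otd : edgeHead fst snd o etd = t := by
    have := hd etd (Or.inr hetd.2)
    cases h : o etd <;> simp_all [edgeHead, edgeTail]
  have ors : edgeTail fst snd o ers = s := by
    have hne : edgeTail fst snd o ers ≠ r := fun h => by
      have := head_pos _ _ odr
      have := tail_pos _ _ h
      omega
    cases h : o ers <;> simp_all [edgeTail]
  have ost : edgeHead fst snd o est = t := by
    have hne : edgeHead fst snd o est ≠ s := fun h => by
      have := head_pos _ _ h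
      have := tail_pos _ _ ors
      omega
    cases h : o est <;> simp_all [edgeHead]
  have two_in : 1 < (univ.filter (fun e => edgeHead fst snd o e = t)).card :=
    one_lt_card.mpr ⟨est, by simpa using ost, etd, by simpa using otd, hedist.2.2.2.2.2⟩
  omega
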